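/- Let $s \in S$, $t \in T$, and $a \in A$. In the fractional skew monoid ring $S^{op} *_\alpha A *_\alpha T$, one has $s_- \phi(a) t_+ = 0$ if and only if $p_s a p_t \in \ker(\alpha_{s'})$ for some $s' \in S$. In particular, $\ker(\phi) = \bigcup_{s' \in S} \ker(\alpha_{s'})$. -/

import Mathlib

universe u v w

/-- The defining relations of the fractional skew monoid ring `Sᵒᵖ *_α A *_α T` for a
submonoid `S` of a monoid `T`. -/
def FSMRRelationsT {A : Type u} {T : Type v} {R : Type w} [Ring A] [Monoid T] [Ring R]
    (S : Submonoid T) (α : T → A → A) (φ : A → R) (minus : S → R) (plus : T → R) : Prop :=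
  (∀ a b : A, φ (a + b) = φ a + φ b) ∧ (∀ a b : A, φ (a * b) = φ a * φ b) ∧ φ 1 = 1 ∧
  plus 1 = 1 ∧ (∀ s t : T, plus (s * t) = plus s * plus t) ∧
  minus 1 = 1 ∧ (∀ s t : S, minus (s * t) = minus t * minus s) ∧
  (∀ (t : T) (a : A), plus t * φ a = φ (α t a) * plus t) ∧
  (∀ (s : S) (a : A), φ a * minus s = minus s * φ (α (s : T) a)) ∧
  (∀ s : S, minus s * plus (s : T) = 1) ∧
  (∀ s : S, plus (s : T) * minus s = φ (α (s : T) 1))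

/-- `R` is *the* (universal) fractional skew monoid ring `Sᵒᵖ *_α A *_α T`. -/
def IsFSMRT {A : Type u} {T : Type v} {R : Type w} [Ring A] [Monoid T] [Ring R]
    (S : Submonoid T) (α : T → A → A) (φ : A → R) (minus : S → R) (plus : T → R) : Prop :=
  FSMRRelationsT S α φ minus plus ∧
  ∀ (R' : Type (max u v w)) [Ring R'] (φ' : A → R') (minus' : S → R') (plus' : T → R'),
    FSMRRelationsT S α φ' minus' plus' →
    ∃! ψ : R →+* R', (∀ a : A, ψ (φ a) = φ' a) ∧
      (∀ s : S, ψ (minus s) = minus' s) ∧ (∀ t : T, ψ (plus t) = plus' t)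

namespace FractionalSkew

open OreLocalization

/-- Restricting a nonunital model of the relations, in which the elements of `S` act invertibly,
to the corner cut out by the idempotent `f 1` gives a unital model. -/
theorem relations_corner {A : Type u} {T : Type v} {E : Type*} [Ring A] [Monoid T] [Ring E]
    {S : Submonoid T} {α : T → A → A}
    (hmul : ∀ (t : T) (a b : A), α t (a * b) = α t a * α t b)
    (hone : ∀ a : A, α 1 a = a)
    (hcomp : ∀ (s t : T) (a : A), α (s * t) a = α s (α t a))
    (f : A →ₙ+* E) (P : T →* E) (Q : S → E)
    (hPf : ∀ t a, P t * f a = f (α t a) * P t)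
    (hQP : ∀ s : S, Q s * P s = 1) (hPQ : ∀ s : S, P s * Q s = 1)
    (hf : IsIdempotentElem (f 1)) :
    ∃ (φ : A → ULift.{w} hf.Corner) (minus : S → ULift.{w} hf.Corner)
      (plus : T → ULift.{w} hf.Corner),
      FSMRRelationsT S α φ minus plus ∧ (∀ a, ((φ a).down).1 = f a) ∧
        ∀ t, ((plus t).down).1 = f (α t 1) * P t := by
  have hf1 (a : A) : f 1 * f a = f a := by rw [← map_mul, one_mul]
  have hf1' (a : A) : f a * f 1 = f a := by rw [← map_mul, mul_one]
  have hff (a b : A) (x : E) : f a * (f b * x) = f (a * b) * x := by rw [map_mul, mul_assoc]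
  have hPf' (t : T) (a : A) (x : E) : P t * (f a * x) = f (α t a) * (P t * x) := by
    rw [← mul_assoc, hPf, mul_assoc]
  have hQP' (s : S) (x : E) : Q s * (P s * x) = x := by rw [← mul_assoc, hQP, one_mul]
  have hPQ' (s : S) (x : E) : P s * (Q s * x) = x := by rw [← mul_assoc, hPQ, one_mul]
  have hfQ (s : S) (a : A) : f a * Q s = Q s * f (α s a) := by
    calc f a * Q s = Q s * (P s * (f a * Q s)) := (hQP' s _).symm
      _ = Q s * f (α s a) := by rw [hPf', hPQ, mul_one]
  have hQ1 : Q 1 = 1 := by simpa using hQP 1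
  have hQmul (s t : S) : Q (s * t) = Q t * Q s := by
    have h : P (s * t : S) * (Q t * Q s) = 1 := by
      rw [Submonoid.coe_mul, map_mul, mul_assoc, hPQ', hPQ]
    calc Q (s * t) = Q (s * t) * (P (s * t : S) * (Q t * Q s)) := by rw [h, mul_one]
      _ = Q t * Q s := hQP' _ _
  have hα (t : T) (a : A) : α t 1 * α t a = α t a := by rw [← hmul, one_mul]
  have hα' (t : T) (a : A) : α t a * α t 1 = α t a := by rw [← hmul, mul_one]
  refine ⟨fun a => ⟨f a, (Subsemigroup.mem_corner_iff hf).2 ⟨hf1 a, hf1' a⟩⟩,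
    fun s => ⟨Q s * f (α s 1), (Subsemigroup.mem_corner_iff hf).2 ⟨?_, ?_⟩⟩,
    fun t => ⟨f (α t 1) * P t, (Subsemigroup.mem_corner_iff hf).2 ⟨?_, ?_⟩⟩,
    ⟨?_, ?_, ?_, ?_, ?_, ?_, ?_, ?_, ?_, ?_, ?_⟩, fun _ => rfl, fun _ => rfl⟩
  · rw [← mul_assoc, hfQ, mul_assoc, ← map_mul, hα]
  · rw [mul_assoc, hf1']
  · rw [← mul_assoc, hf1]
  · rw [mul_assoc, hPf, hff, hα]
  · exact fun a b => ULift.ext _ _ (Subtype.ext (map_add f a b))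
  · exact fun a b => ULift.ext _ _ (Subtype.ext (map_mul f a b))
  · rfl
  · refine ULift.ext _ _ (Subtype.ext ?_)
    change f (α 1 1) * P 1 = f 1
    rw [hone, P.map_one, mul_one]
  · refine fun s t => ULift.ext _ _ (Subtype.ext ?_)
    change f (α (s * t) 1) * P (s * t) = f (α s 1) * P s * (f (α t 1) * P t)
    rw [mul_assoc, hPf', hff, hα, hcomp, map_mul]
  · refine ULift.ext _ _ (Subtype.ext ?_)
    change Q 1 * f (α (1 : S) 1) = f 1
    rw [hQ1, one_mul, Submonoid.coe_one, hone]
  · refine fun s t => ULift.ext _ _ (Subtype.ext ?_)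
    change Q (s * t) * f (α (s * t : S) 1) = Q t * f (α t 1) * (Q s * f (α s 1))
    rw [hQmul, mul_assoc, mul_assoc, ← mul_assoc (f _), hfQ, mul_assoc, ← map_mul, hα',
      Submonoid.coe_mul, hcomp]
  · refine fun t a => ULift.ext _ _ (Subtype.ext ?_)
    change f (α t 1) * P t * f a = f (α t a) * (f (α t 1) * P t)
    rw [mul_assoc, hPf, hff, hff, hα, hα']
  · refine fun s a => ULift.ext _ _ (Subtype.ext ?_)
    change f a * (Q s * f (α s 1)) = Q s * f (α s 1) * f (α s a)
    rw [← mul_assoc, hfQ, mul_assoc, mul_assoc, ← map_mul, ← map_mul, hα, hα']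
  · refine fun s => ULift.ext _ _ (Subtype.ext ?_)
    change Q s * f (α s 1) * (f (α s 1) * P s) = f 1
    rw [mul_assoc, hff, hα, ← mul_assoc, ← hfQ, mul_assoc, hQP, mul_one]
  · refine fun s => ULift.ext _ _ (Subtype.ext ?_)
    change f (α s 1) * P s * (Q s * f (α s 1)) = f (α s 1)
    rw [mul_assoc, hPQ', ← map_mul, hα]

section OreModule

variable {A T X : Type*} [Ring A] [Monoid T] {S : Submonoid T} [OreSet S] {α : T → A → A}
  [AddCommGroup X] [DistribMulAction T X] [Module A X]

/-- The twisted action of `a : A` on the Ore localization of a skew module, sending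
`x /ₒ s` to `(α s a • x) /ₒ s`. -/
def twistedSMul (hcomp : ∀ (s t : T) (a : A), α (s * t) a = α s (α t a))
    (hsmul : ∀ (t : T) (a : A) (x : X), t • a • x = α t a • t • x) (a : A) :
    AddMonoid.End (OreLocalization S X) where
  toFun := OreLocalization.liftExpand (fun x s => (α s a • x) /ₒ s) fun x t s ht => by
    rw [OreLocalization.expand _ s t ht, hsmul, hcomp]
  map_zero' := by
    rw [OreLocalization.zero_def, OreLocalization.liftExpand_of, smul_zero]
  map_add' x y := by
    induction x with | _ x s
    induction y with | _ y t
    obtain ⟨r, u, h, -⟩ := oreDivAddChar' x y s t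
    rw [oreDiv_add_char s t r u h]
    simp only [OreLocalization.liftExpand_of]
    rw [oreDiv_add_char s t r u h, smul_add, Submonoid.smul_def, Submonoid.smul_def, hsmul, hsmul,
      ← hcomp, ← hcomp, Submonoid.coe_mul, h]

/-- The twisted action of `A` on the Ore localization of a skew module. -/
def twistedSMulHom (hadd : ∀ (t : T) (a b : A), α t (a + b) = α t a + α t b)
    (hmul : ∀ (t : T) (a b : A), α t (a * b) = α t a * α t b)
    (hcomp : ∀ (s t : T) (a : A), α (s * t) a = α s (α t a))
    (hsmul : ∀ (t : T) (a : A) (x : X), t • a • x = α t a • t • x) :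
    A →ₙ+* AddMonoid.End (OreLocalization S X) where
  toFun := twistedSMul hcomp hsmul
  map_mul' a b := by
    ext x
    induction x with | _ x s
    change (α s (a * b) • x) /ₒ s = (α s a • α s b • x) /ₒ s
    rw [hmul, mul_smul]
  map_zero' := by
    ext x
    induction x with | _ x s
    have h : α s 0 = 0 := by simpa using hadd s 0 0
    change (α s 0 • x) /ₒ s = 0
    rw [h, zero_smul, zero_oreDiv]
  map_add' a b := by
    ext x
    induction x with | _ x s
    change (α s (a + b) • x) /ₒ s = (α s a • x) /ₒ s + (α s b • x) /ₒ s
    rw [hadd, add_smul, add_oreDiv]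

theorem smul_twistedSMul (hcomp : ∀ (s t : T) (a : A), α (s * t) a = α s (α t a))
    (hsmul : ∀ (t : T) (a : A) (x : X), t • a • x = α t a • t • x) (t : T) (a : A)
    (x : OreLocalization S X) :
    (numeratorHom t : OreLocalization S T) • twistedSMul hcomp hsmul a x =
      twistedSMul hcomp hsmul (α t a) ((numeratorHom t : OreLocalization S T) • x) := by
  induction x with | _ x s
  obtain ⟨r, u, h, -⟩ := oreDivSMulChar' t x 1 s
  rw [numeratorHom_apply, oreDiv_smul_char t x 1 s r u h]
  change _ • ((α s a • x) /ₒ s) = (α ↑(u * 1) (α t a) • r • x) /ₒ (u * 1)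
  rw [oreDiv_smul_char t _ 1 s r u h, hsmul, ← hcomp, ← hcomp, mul_one, h]

end OreModule

/-- A relation `φ a * plus t = 0` in the universal ring is witnessed in every skew module. -/
theorem exists_smul_eq_zero {A : Type u} {T : Type v} {R : Type w} {X : Type (max u v)}
    [Ring A] [Monoid T] [Ring R] {S : Submonoid T} [OreSet S] {α : T → A → A}
    [AddCommGroup X] [DistribMulAction T X] [Module A X]
    (hadd : ∀ (t : T) (a b : A), α t (a + b) = α t a + α t b)
    (hmul : ∀ (t : T) (a b : A), α t (a * b) = α t a * α t b)
    (hone : ∀ a : A, α 1 a = a)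
    (hcomp : ∀ (s t : T) (a : A), α (s * t) a = α s (α t a))
    (hsmul : ∀ (t : T) (a : A) (x : X), t • a • x = α t a • t • x)
    {φ : A → R} {minus : S → R} {plus : T → R} (huniv : IsFSMRT S α φ minus plus)
    {a : A} {t : T} (h : φ a * plus t = 0) (x : X) :
    ∃ s : S, (s : T) • (a * α t 1) • t • x = 0 := by
  let f : A →ₙ+* AddMonoid.End (OreLocalization S X) := twistedSMulHom hadd hmul hcomp hsmul
  let L := DistribMulAction.toAddMonoidEnd (OreLocalization S T) (OreLocalization S X)
  let P : T →* AddMonoid.End (OreLocalization S X) := L.comp numeratorHom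
  let Q (s : S) : AddMonoid.End (OreLocalization S X) := L (1 /ₒ s)
  have hf : IsIdempotentElem (f 1) := by
    change f 1 * f 1 = f 1
    rw [← map_mul, mul_one]
  obtain ⟨φ', minus', plus', hrel, hφ', hplus'⟩ :=
    relations_corner (S := S) hmul hone hcomp f P Q
      (fun t a => AddMonoidHom.ext fun x => smul_twistedSMul hcomp hsmul t a x)
      (fun s => (map_mul L _ _).symm.trans
        ((congrArg L (numeratorUnit s).inv_val).trans (map_one L)))
      (fun s => (map_mul L _ _).symm.trans
        ((congrArg L (numeratorUnit s).val_inv).trans (map_one L)))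
      hf
  obtain ⟨ψ, ⟨hψφ, -, hψp⟩, -⟩ := huniv.2 _ φ' minus' plus' hrel
  have h0 : φ' a * plus' t = 0 := by rw [← hψφ, ← hψp, ← map_mul, h, map_zero]
  have h1 : f (a * α t 1) * P t = 0 := by
    rw [map_mul, mul_assoc, ← hφ', ← hplus']
    exact congrArg (fun y => y.down.1) h0
  have h2 : P t (x /ₒ (1 : S)) = (t • x) /ₒ 1 := smul_div_one
  have h3 : ((a * α t 1) • t • x) /ₒ (1 : S) = 0 := by
    calc _ = f (a * α t 1) ((t • x) /ₒ (1 : S)) := by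
          change _ = (α (1 : S) (a * α t 1) • t • x) /ₒ (1 : S)
          rw [Submonoid.coe_one, hone]
      _ = (f (a * α t 1) * P t) (x /ₒ (1 : S)) := by rw [← h2]; rfl
      _ = 0 := by rw [h1]; rfl
  rw [OreLocalization.zero_def, eq_comm, oreDiv_eq_iff] at h3
  obtain ⟨s, r, h4, -⟩ := h3
  exact ⟨s, by rwa [smul_zero] at h4⟩

/-- The endomorphism `a • u ↦ α t a • (t * u)` of `T →₀ A`. -/
noncomputable def skewShift {A T : Type*} [Ring A] [Monoid T] (α : T →* AddMonoid.End A) :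
    T →* AddMonoid.End (T →₀ A) where
  toFun t := Finsupp.liftAddHom fun u => (Finsupp.singleAddHom (t * u)).comp (α t)
  map_one' := by
    refine Finsupp.addHom_ext fun u a => ?_
    rw [Finsupp.liftAddHom_apply_single, one_mul, map_one]
    rfl
  map_mul' s t := by
    refine Finsupp.addHom_ext fun u a => ?_
    have h (r v : T) (b : A) :
        Finsupp.liftAddHom (fun u => (Finsupp.singleAddHom (r * u)).comp (α r))
          (Finsupp.single v b) = Finsupp.single (r * v) (α r b) :=
      Finsupp.liftAddHom_apply_single _ _ _
    refine (h _ _ _).trans (Eq.symm ((congrArg _ (h t u a)).trans ((h _ _ _).trans ?_)))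
    rw [mul_assoc, map_mul]
    rfl

theorem skewShift_single {A T : Type*} [Ring A] [Monoid T] (α : T →* AddMonoid.End A)
    (t u : T) (a : A) :
    skewShift α t (Finsupp.single u a) = Finsupp.single (t * u) (α t a) :=
  Finsupp.liftAddHom_apply_single _ _ _

theorem skewShift_smul {A T : Type*} [Ring A] [Monoid T] (α : T →* AddMonoid.End A)
    (hmul : ∀ (t : T) (a b : A), α t (a * b) = α t a * α t b) (t : T) (a : A) (x : T →₀ A) :
    skewShift α t (a • x) = α t a • skewShift α t x := by
  induction x using Finsupp.induction_linear with
  | zero => simp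
  | add x y hx hy => simp only [smul_add, map_add, hx, hy]
  | single u b =>
    rw [Finsupp.smul_single, skewShift_single, skewShift_single, Finsupp.smul_single,
      smul_eq_mul, smul_eq_mul, hmul]

/-- A relation `φ a * plus t = 0` in the universal ring is witnessed in `A`. -/
theorem exists_apply_eq_zero {A : Type u} {T : Type v} {R : Type w} [Ring A] [Monoid T] [Ring R]
    (S : Submonoid T) (α : T → A → A)
    (hadd : ∀ (t : T) (a b : A), α t (a + b) = α t a + α t b)
    (hmul : ∀ (t : T) (a b : A), α t (a * b) = α t a * α t b)
    (hone : ∀ a : A, α 1 a = a)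
    (hcomp : ∀ (s t : T) (a : A), α (s * t) a = α s (α t a))
    (hOre : ∀ (s : S) (t : T), ∃ (s' : S) (t' : T), (s' : T) * t = t' * s)
    (hRev : ∀ (t u : T) (s : S), t * s = u * s → ∃ s' : S, (s' : T) * t = (s' : T) * u)
    {φ : A → R} {minus : S → R} {plus : T → R} (huniv : IsFSMRT S α φ minus plus)
    {a : A} {t : T} (h : φ a * plus t = 0) :
    ∃ s' : S, α s' (a * α t 1) = 0 := by
  choose den num hnum using hOre
  let : OreSet S :=
    { ore_right_cancel := hRev
      oreNum := fun t s => num s t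
      oreDenom := fun t s => den s t
      ore_eq := fun t s => hnum s t }
  let αHom : T →* AddMonoid.End A :=
    { toFun := fun t => AddMonoidHom.mk' (α t) (hadd t)
      map_one' := AddMonoidHom.ext hone
      map_mul' := fun s t => AddMonoidHom.ext (hcomp s t) }
  let : DistribMulAction T (T →₀ A) := DistribMulAction.compHom _ (skewShift αHom)
  have hsmul (t : T) (a : A) (x : T →₀ A) : t • a • x = α t a • t • x :=
    skewShift_smul αHom hmul t a x
  have hsingle (t u : T) (a : A) :
      t • Finsupp.single u a = Finsupp.single (t * u) (α t a) :=
    skewShift_single αHom t u a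
  obtain ⟨s, hs⟩ :=
    exists_smul_eq_zero hadd hmul hone hcomp hsmul huniv h (Finsupp.single (1 : T) (1 : A))
  refine ⟨s, ?_⟩
  rw [hsingle, Finsupp.smul_single, hsingle, Finsupp.single_eq_zero] at hs
  rwa [smul_eq_mul, mul_assoc, ← hmul, one_mul] at hs

end FractionalSkew

/-- In the universal fractional skew monoid ring `Sᵒᵖ *_α A *_α T` (with
`S` a left denominator submonoid, left saturated in `T`), `s₋ φ(a) t₊ = 0` iff
`p_s a p_t ∈ ker α_{s'}` for some `s' ∈ S`; in particular
`ker φ = ⋃_{s' ∈ S} ker α_{s'}`. -/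
theorem stmt10 {A : Type u} {T : Type v} {R : Type w} [Ring A] [Monoid T] [Ring R]
    (S : Submonoid T) (α : T → A → A)
    (hadd : ∀ (t : T) (a b : A), α t (a + b) = α t a + α t b)
    (hmul : ∀ (t : T) (a b : A), α t (a * b) = α t a * α t b)
    (hone : ∀ a : A, α 1 a = a)
    (hcomp : ∀ (s t : T) (a : A), α (s * t) a = α s (α t a))
    (hOre : ∀ (s : S) (t : T), ∃ (s' : S) (t' : T), (s' : T) * t = t' * s)
    (hRev : ∀ (t u : T) (s : S), t * s = u * s → ∃ s' : S, (s' : T) * t = (s' : T) * u)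
    (hSat : ∀ (t : T) (s : S), t * (s : T) ∈ S → t ∈ S)
    (φ : A → R) (minus : S → R) (plus : T → R)
    (huniv : IsFSMRT S α φ minus plus) :
    (∀ (s : S) (t : T) (a : A),
      minus s * φ a * plus t = 0 ↔ ∃ s' : S, α (s' : T) (α (s : T) 1 * a * α t 1) = 0) ∧
    (∀ b : A, φ b = 0 ↔ ∃ s' : S, α (s' : T) b = 0) := by
  have hmain {a : A} {t : T} (h : φ a * plus t = 0) : ∃ s' : S, α s' (a * α t 1) = 0 :=
    FractionalSkew.exists_apply_eq_zero S α hadd hmul hone hcomp hOre hRev huniv h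
  obtain ⟨fadd, fmul, fone, -, -, -, -, hpf, hfm, hmp, hpm⟩ := huniv.1
  have hφ0 : φ 0 = 0 := by simpa using fadd 0 0
  have hker {b : A} {s : S} (h : α s b = 0) : φ b = 0 := by
    calc φ b = minus s * (plus s * φ b) := by rw [← mul_assoc, hmp, one_mul]
      _ = 0 := by rw [hpf, h, hφ0, zero_mul, mul_zero]
  have hm (s : S) : minus s * φ (α s 1) = minus s := by
    rw [← hfm, fone, one_mul]
  have hp (t : T) : φ (α t 1) * plus t = plus t := by
    rw [← hpf, fone, mul_one]
  refine ⟨fun s t a => ⟨fun h => ?_, fun ⟨s', h⟩ => ?_⟩,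
    fun b => ⟨fun h => ?_, fun ⟨s', h⟩ => hker h⟩⟩
  · refine hmain ?_
    rw [fmul, ← hpm, mul_assoc, mul_assoc, ← mul_assoc (minus s), h, mul_zero]
  · rw [← hm, ← hp t]
    have := hker h
    rw [fmul, fmul] at this
    simp only [mul_assoc] at this ⊢
    rw [← mul_assoc (φ a), ← mul_assoc (φ _), this, zero_mul, mul_zero]
  · obtain ⟨s', hs'⟩ := hmain (a := b) (t := 1) (by rw [h, zero_mul])
    exact ⟨s', by rwa [hone, mul_one] at hs'⟩
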